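/- arXiv:2501.06302 — 6 statements merged into one kernel-verified Lean document; each statement's English description precedes it below -/
import Mathlib

section
/- For every natural number n, the map (A,u) ↦ (A, sign(u)) is a group isomorphism from SLₙᶜ(ℝ) = {(A,u) ∈ GLₙ(ℝ) × ℝˣ : det A = u²} onto the direct product GLₙ⁺(ℝ) × {±1}, where GLₙ⁺(ℝ) is the subgroup of GLₙ(ℝ) consisting of matrices of positive determinant and {±1} is the group of order 2. In particular, the projection (A,u) ↦ A maps SLₙᶜ(ℝ) onto GLₙ⁺(ℝ) with kernel {(Iₙ, 1), (Iₙ, −1)} of order 2. -/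
open Matrix

/-- The metalinear group `SLₙᶜ(ℝ) = {(A, u) ∈ GLₙ(ℝ) × ℝˣ : det A = u²}` as a
subgroup of `GLₙ(ℝ) × ℝˣ`. -/
def SLcReal (n : ℕ) : Subgroup (GL (Fin n) ℝ × ℝˣ) where
  carrier := {p | Matrix.GeneralLinearGroup.det p.1 = p.2 ^ 2}
  one_mem' := by simp
  mul_mem' := by
    intro a b ha hb
    simp only [Set.mem_setOf_eq, Prod.fst_mul, Prod.snd_mul, _root_.map_mul, mul_pow] at *
    rw [ha, hb]
  inv_mem' := by
    intro a ha
    simp only [Set.mem_setOf_eq, Prod.fst_inv, Prod.snd_inv, map_inv, inv_pow] at *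
    rw [ha]

/-- The sign homomorphism `ℝˣ → {±1}`. -/
noncomputable def realUnitsSign : ℝˣ →* ℤˣ where
  toFun u := if (0 : ℝ) < u then 1 else -1
  map_one' := by simp
  map_mul' u v := by
    rcases lt_or_gt_of_ne u.ne_zero with hu | hu <;> rcases lt_or_gt_of_ne v.ne_zero with hv | hv
    · simp [mul_pos_of_neg_of_neg hu hv, hu.not_gt, hv.not_gt]
    · simp [(mul_neg_of_neg_of_pos hu hv).not_gt, hu.not_gt, hv]
    · simp [(mul_neg_of_pos_of_neg hu hv).not_gt, hu, hv.not_gt]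
    · simp [mul_pos hu hv, hu, hv]

theorem realUnitsSign_apply (u : ℝˣ) : realUnitsSign u = if (0 : ℝ) < u then 1 else -1 := rfl

theorem realUnitsSign_neg (u : ℝˣ) : realUnitsSign (-u) = -realUnitsSign u := by
  rcases lt_or_gt_of_ne u.ne_zero with hu | hu
  · simp [realUnitsSign_apply, hu, hu.not_gt]
  · simp [realUnitsSign_apply, hu, hu.not_gt]

/-- A real unit is determined by its square and its sign. -/
theorem realUnits_eq_of_sq_eq_of_sign_eq {u v : ℝˣ} (hsq : u ^ 2 = v ^ 2)
    (hsign : realUnitsSign u = realUnitsSign v) : u = v := by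
  have hsq' : (u : ℝ) ^ 2 = (v : ℝ) ^ 2 := by exact_mod_cast congrArg Units.val hsq
  rcases sq_eq_sq_iff_eq_or_eq_neg.mp hsq' with h | h
  · exact Units.ext h
  · have huv : u = -v := Units.ext (by simpa using h)
    rw [huv, realUnitsSign_neg] at hsign
    exact absurd hsign.symm (units_ne_neg_self _)

/-- A positive real unit has a square root of either sign. -/
theorem exists_sq_eq_and_realUnitsSign_eq {d : ℝˣ} (hd : (0 : ℝ) < d) (s : ℤˣ) :
    ∃ u : ℝˣ, d = u ^ 2 ∧ realUnitsSign u = s := by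
  have hpos : 0 < √(d : ℝ) := Real.sqrt_pos.mpr hd
  let r : ℝˣ := Units.mk0 (√(d : ℝ)) hpos.ne'
  have hr : d = r ^ 2 := Units.ext (by simp [r, Real.sq_sqrt hd.le])
  have hrs : realUnitsSign r = 1 := by simp [realUnitsSign_apply, r, hd]
  rcases Int.units_eq_one_or s with rfl | rfl
  · exact ⟨r, hr, hrs⟩
  · exact ⟨-r, by rw [neg_sq, hr], by rw [realUnitsSign_neg, hrs]⟩

theorem mem_SLcReal {n : ℕ} {p : GL (Fin n) ℝ × ℝˣ} :
    p ∈ SLcReal n ↔ Matrix.GeneralLinearGroup.det p.1 = p.2 ^ 2 := Iff.rfl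

theorem fst_mem_GLPos_of_mem_SLcReal {n : ℕ} {p : GL (Fin n) ℝ × ℝˣ} (hp : p ∈ SLcReal n) :
    p.1 ∈ Matrix.GLPos (Fin n) ℝ := by
  rw [Matrix.mem_glpos, mem_SLcReal.mp hp, Units.val_pow_eq_pow_val]
  exact sq_pos_of_ne_zero p.2.ne_zero

/-- The homomorphism `(A, u) ↦ (A, sign u)`. -/
noncomputable def SLcReal.toGLPosProdSign (n : ℕ) :
    SLcReal n →* Matrix.GLPos (Fin n) ℝ × ℤˣ :=
  (((MonoidHom.fst _ _).comp (SLcReal n).subtype).codRestrict (Matrix.GLPos (Fin n) ℝ)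
    fun p => fst_mem_GLPos_of_mem_SLcReal p.2).prod
    (realUnitsSign.comp ((MonoidHom.snd _ _).comp (SLcReal n).subtype))

theorem SLcReal.toGLPosProdSign_bijective (n : ℕ) :
    Function.Bijective (SLcReal.toGLPosProdSign n) := by
  constructor
  · rintro ⟨⟨A, u⟩, hu⟩ ⟨⟨B, v⟩, hv⟩ h
    obtain rfl : A = B := congrArg (fun q => (q.1 : GL (Fin n) ℝ)) h
    obtain rfl : u = v := realUnits_eq_of_sq_eq_of_sign_eq
      ((mem_SLcReal.mp hu).symm.trans (mem_SLcReal.mp hv)) (congrArg Prod.snd h)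
    rfl
  · rintro ⟨⟨A, hA⟩, s⟩
    obtain ⟨u, hu, hs⟩ := exists_sq_eq_and_realUnitsSign_eq ((Matrix.mem_glpos A).mp hA) s
    exact ⟨⟨(A, u), hu⟩, Prod.ext rfl hs⟩

/-- The map `(A, u) ↦ (A, sign u)` is a group isomorphism from
`SLₙᶜ(ℝ) = {(A, u) : det A = u²}` onto `GLₙ⁺(ℝ) × {±1}`; in particular the
projection `(A, u) ↦ A` maps `SLₙᶜ(ℝ)` onto `GLₙ⁺(ℝ)` with kernel
`{(Iₙ, 1), (Iₙ, −1)}` of order 2. -/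
theorem slc_real_iso_glpos_prod_sign (n : ℕ) :
    (∃ e : SLcReal n ≃* (Matrix.GLPos (Fin n) ℝ) × ℤˣ,
        ∀ p : SLcReal n,
          ((e p).1 : GL (Fin n) ℝ) = p.1.1 ∧
            (e p).2 = if (0 : ℝ) < (p.1.2 : ℝ) then 1 else -1) ∧
      (∀ A : GL (Fin n) ℝ,
          (∃ p : SLcReal n, p.1.1 = A) ↔ A ∈ Matrix.GLPos (Fin n) ℝ) ∧
      (∀ p : SLcReal n,
          p.1.1 = 1 ↔
            (p.1 = ((1 : GL (Fin n) ℝ), (1 : ℝˣ)) ∨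
              p.1 = ((1 : GL (Fin n) ℝ), (-1 : ℝˣ)))) := by
  refine ⟨⟨MulEquiv.ofBijective _ (SLcReal.toGLPosProdSign_bijective n), fun p => ⟨rfl, rfl⟩⟩,
    fun A => ⟨?_, fun hA => ?_⟩, ?_⟩
  · rintro ⟨p, rfl⟩
    exact fst_mem_GLPos_of_mem_SLcReal p.2
  · obtain ⟨u, hu, -⟩ := exists_sq_eq_and_realUnitsSign_eq ((Matrix.mem_glpos A).mp hA) 1
    exact ⟨⟨(A, u), hu⟩, rfl⟩
  · rintro ⟨⟨A, u⟩, hu⟩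
    constructor
    · rintro rfl
      have hsq : u ^ 2 = 1 := by simpa using (mem_SLcReal.mp hu).symm
      have hsq' : (u : ℝ) ^ 2 = 1 := by simpa using congrArg Units.val hsq
      rcases (by simpa using hsq' : (u : ℝ) = 1 ∨ (u : ℝ) = -1) with h | h
      · exact Or.inl (Prod.ext rfl (Units.ext h))
      · exact Or.inr (Prod.ext rfl (Units.ext (by simpa using h)))
    · rintro (h | h) <;> exact congrArg Prod.fst h
end

section
/- For all finite sets J, J' of positive integers, the identity d(c_J)·d(c_{J'}) = Σ_{k∈J} bₖ · P_{(J∖{k})∩J'} · d(c_{Δ(J∖{k}, J')}) holds in R (when J = ∅ both sides are 0). -/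
open MvPolynomial

/-- Variables of the polynomial ring `R = 𝔽₂[θ, a₁, b₁, a₂, b₂, …]`:
`θ` models the class of the square-root line bundle `Θ`, `a k` models the
mod-2 Chern class `c̄_{2k}` and `b k` models `c̄_{2k+1}`. -/
inductive MVar : Type
  | theta : MVar
  | a : ℕ+ → MVar
  | b : ℕ+ → MVar

/-- The class `θ`. -/
noncomputable def θp : MvPolynomial MVar (ZMod 2) := X MVar.theta

/-- `c_J = ∏_{k ∈ J} aₖ`, modelling the product of even Chern classes `c̄_{2k}`. -/
noncomputable def cP (J : Finset ℕ+) : MvPolynomial MVar (ZMod 2) :=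
  ∏ k ∈ J, X (MVar.a k)

/-- `P_J = ∏_{k ∈ J} aₖ²`, modelling the product of Pontryagin-class reductions. -/
noncomputable def PP (J : Finset ℕ+) : MvPolynomial MVar (ZMod 2) :=
  ∏ k ∈ J, (X (MVar.a k)) ^ 2

theorem cP_mul_cP (A B : Finset ℕ+) :
    cP A * cP B = PP (A ∩ B) * cP (symmDiff A B) := by
  have hA : cP A = cP (A \ B) * cP (A ∩ B) := by
    unfold cP
    rw [mul_comm, Finset.prod_inter_mul_prod_sdiff]
  have hB : cP B = cP (B \ A) * cP (A ∩ B) := by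
    unfold cP
    rw [mul_comm, Finset.inter_comm, Finset.prod_inter_mul_prod_sdiff]
  have hΔ : cP (symmDiff A B) = cP (A \ B) * cP (B \ A) :=
    Finset.prod_union disjoint_sdiff_sdiff
  have hP : PP (A ∩ B) = cP (A ∩ B) ^ 2 := Finset.prod_pow _ _ _
  rw [hΔ, hP, hA, hB]
  ring

theorem derivation_PP
    (d : Derivation (ZMod 2) (MvPolynomial MVar (ZMod 2)) (MvPolynomial MVar (ZMod 2)))
    (J : Finset ℕ+) : d (PP J) = 0 := by
  have hP : PP J = cP J ^ 2 := Finset.prod_pow _ _ _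
  rw [hP, Derivation.leibniz_pow, CharTwo.two_nsmul]

theorem derivation_cP
    (d : Derivation (ZMod 2) (MvPolynomial MVar (ZMod 2)) (MvPolynomial MVar (ZMod 2)))
    (ha : ∀ k : ℕ+, d (X (MVar.a k)) = X (MVar.b k)) (J : Finset ℕ+) :
    d (cP J) = ∑ k ∈ J, X (MVar.b k) * cP (J.erase k) := by
  induction J using Finset.induction_on with
  | empty => simp [cP]
  | insert k J hk ih =>
    have hc : cP (insert k J) = X (MVar.a k) * cP J := Finset.prod_insert hk
    have hterm (l : ℕ+) (hl : l ∈ J) :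
        cP ((insert k J).erase l) = X (MVar.a k) * cP (J.erase l) := by
      rw [Finset.erase_insert_of_ne (ne_of_mem_of_not_mem hl hk).symm]
      exact Finset.prod_insert fun h => hk (Finset.mem_of_mem_erase h)
    rw [hc, Derivation.leibniz, ih, ha, smul_eq_mul, smul_eq_mul, Finset.sum_insert hk,
      Finset.erase_insert hk, Finset.mul_sum, add_comm, mul_comm (cP J)]
    congr 1
    refine Finset.sum_congr rfl fun l hl => ?_
    rw [hterm l hl]
    ring

theorem derivation_derivation_cP
    (d : Derivation (ZMod 2) (MvPolynomial MVar (ZMod 2)) (MvPolynomial MVar (ZMod 2)))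
    (ha : ∀ k : ℕ+, d (X (MVar.a k)) = X (MVar.b k))
    (hb : ∀ k : ℕ+, d (X (MVar.b k)) = 0) (J : Finset ℕ+) :
    d (d (cP J)) = 0 := by
  induction J using Finset.induction_on with
  | empty => simp [cP]
  | insert k J hk ih =>
    have hc : cP (insert k J) = X (MVar.a k) * cP J := Finset.prod_insert hk
    simp only [hc, Derivation.leibniz, map_add, ha, hb, ih, smul_eq_mul, mul_zero, zero_add]
    rw [mul_comm]
    exact CharTwo.add_self_eq_zero _

/-- The multiplication formula for untwisted Bockstein classes, reduced mod 2:
for the 𝔽₂-derivation `d` with `d θ = θ²`, `d aₖ = bₖ`, `d bₖ = 0` (modelling `Sq²`)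
and all finite sets `J, J'` of positive integers,
`d(c_J)·d(c_{J'}) = Σ_{k∈J} bₖ · P_{(J∖{k})∩J'} · d(c_{Δ(J∖{k},J')})`. -/
theorem bockstein_product_untwisted
    (d : Derivation (ZMod 2) (MvPolynomial MVar (ZMod 2)) (MvPolynomial MVar (ZMod 2)))
    (hθ : d θp = θp ^ 2)
    (ha : ∀ k : ℕ+, d (X (MVar.a k)) = X (MVar.b k))
    (hb : ∀ k : ℕ+, d (X (MVar.b k)) = 0)
    (J J' : Finset ℕ+) :
    d (cP J) * d (cP J') =
      ∑ k ∈ J, X (MVar.b k) * PP ((J.erase k) ∩ J') *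
        d (cP (symmDiff (J.erase k) J')) := by
  have hterm (k : ℕ+) : X (MVar.b k) * PP ((J.erase k) ∩ J') *
      d (cP (symmDiff (J.erase k) J')) =
      X (MVar.b k) * cP (J.erase k) * d (cP J') +
        cP J' * (X (MVar.b k) * d (cP (J.erase k))) := by
    have h := congrArg d (cP_mul_cP (J.erase k) J')
    simp only [Derivation.leibniz, derivation_PP, smul_eq_mul, mul_zero, add_zero] at h
    rw [mul_assoc, ← h]
    ring
  have hzero : ∑ k ∈ J, X (MVar.b k) * d (cP (J.erase k)) = 0 := by
    have h := derivation_derivation_cP d ha hb J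
    simpa [derivation_cP d ha J, hb] using h
  rw [Finset.sum_congr rfl fun k _ => hterm k, Finset.sum_add_distrib, ← Finset.sum_mul,
    ← Finset.mul_sum, hzero, mul_zero, add_zero, ← derivation_cP d ha J]
end

section
/- For all finite sets J, J' of positive integers, the identity d(c_J)·D(c_{J'}) = Σ_{k∈J} bₖ · P_{(J∖{k})∩J'} · D(c_{Δ(J∖{k}, J')}) holds in R (when J = ∅ both sides are 0; J' may be empty, with D(c_∅) = θ). -/
open MvPolynomial

/-- The twisted operation `D(p) = d(p) + θ·p`, modelling `Sq²_Θ`. -/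
noncomputable def Dop
    (d : Derivation (ZMod 2) (MvPolynomial MVar (ZMod 2)) (MvPolynomial MVar (ZMod 2)))
    (p : MvPolynomial MVar (ZMod 2)) : MvPolynomial MVar (ZMod 2) :=
  d p + θp * p

/-- Over `𝔽₂` the square of a derivation satisfies the Leibniz rule. -/
theorem Derivation.apply_apply_mul_of_charTwo {R A : Type*} [CommRing R] [CommRing A]
    [Algebra R A] [CharP A 2] (d : Derivation R A A) (p q : A) :
    d (d (p * q)) = d (d p) * q + p * d (d q) := by
  simp only [Derivation.leibniz, map_add, smul_eq_mul]
  linear_combination CharTwo.two_eq_zero (R := A) * (d p * d q)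

theorem Derivation.apply_sq_of_charTwo {R A : Type*} [CommRing R] [CommRing A]
    [Algebra R A] [CharP A 2] (d : Derivation R A A) (p : A) : d (p ^ 2) = 0 := by
  rw [sq, Derivation.leibniz, CharTwo.add_self_eq_zero]

theorem Derivation.apply_finset_prod {R A ι : Type*} [CommRing R] [CommRing A] [Algebra R A]
    [DecidableEq ι] (d : Derivation R A A) (s : Finset ι) (f : ι → A) :
    d (∏ i ∈ s, f i) = ∑ i ∈ s, d (f i) * ∏ j ∈ s.erase i, f j := by
  induction s using Finset.induction_on with
  | empty => simp
  | insert i s hi ih =>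
    rw [Finset.prod_insert hi, Finset.sum_insert hi, Finset.erase_insert hi, Derivation.leibniz,
      ih, smul_eq_mul, smul_eq_mul, Finset.mul_sum, add_comm, mul_comm (∏ j ∈ s, f j)]
    congr 1
    refine Finset.sum_congr rfl fun j hj => ?_
    have hij : i ≠ j := fun h => hi (h ▸ hj)
    rw [Finset.erase_insert_of_ne hij,
      Finset.prod_insert fun h => hi (Finset.mem_of_mem_erase h)]
    ring

theorem PP_eq_sq (J : Finset ℕ+) : PP J = cP J ^ 2 :=
  Finset.prod_pow J 2 _

theorem PP_inter_mul_cP_symmDiff (A B : Finset ℕ+) :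
    PP (A ∩ B) * cP (symmDiff A B) = cP A * cP B := by
  have hdisj : Disjoint (symmDiff A B) (A ∩ B) := disjoint_symmDiff_inf A B
  have hunion : symmDiff A B ∪ A ∩ B = A ∪ B := symmDiff_sup_inf A B
  have h₁ : cP (A ∪ B) = cP (symmDiff A B) * cP (A ∩ B) := by
    rw [← hunion]
    exact Finset.prod_union hdisj
  have h₂ : cP (A ∪ B) * cP (A ∩ B) = cP A * cP B := Finset.prod_union_inter
  rw [PP_eq_sq, ← h₂, h₁]
  ring

theorem Dop_mul (d : Derivation (ZMod 2) (MvPolynomial MVar (ZMod 2)) (MvPolynomial MVar (ZMod 2)))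
    (p q : MvPolynomial MVar (ZMod 2)) : Dop d (p * q) = d p * q + p * Dop d q := by
  simp only [Dop, Derivation.leibniz, smul_eq_mul]
  ring

theorem PP_mul_Dop
    (d : Derivation (ZMod 2) (MvPolynomial MVar (ZMod 2)) (MvPolynomial MVar (ZMod 2)))
    (J : Finset ℕ+) (q : MvPolynomial MVar (ZMod 2)) :
    PP J * Dop d q = Dop d (PP J * q) := by
  rw [Dop_mul, PP_eq_sq, d.apply_sq_of_charTwo, zero_mul, zero_add]

/-- The mixed multiplication formula for Bockstein classes, reduced mod 2:
`d(c_J)·D(c_{J'}) = Σ_{k∈J} bₖ · P_{(J∖{k})∩J'} · D(c_{Δ(J∖{k},J')})`,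
where `d` is the 𝔽₂-derivation with `d θ = θ²`, `d aₖ = bₖ`, `d bₖ = 0`
(modelling `Sq²`) and `D p = d p + θ·p` (modelling `Sq²_Θ`). Here `J, J'` are
finite sets of positive integers; `J'` may be empty, with `D(c_∅) = θ`. -/
theorem bockstein_product_mixed
    (d : Derivation (ZMod 2) (MvPolynomial MVar (ZMod 2)) (MvPolynomial MVar (ZMod 2)))
    (hθ : d θp = θp ^ 2)
    (ha : ∀ k : ℕ+, d (X (MVar.a k)) = X (MVar.b k))
    (hb : ∀ k : ℕ+, d (X (MVar.b k)) = 0)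
    (J J' : Finset ℕ+) :
    d (cP J) * Dop d (cP J') =
      ∑ k ∈ J, X (MVar.b k) * PP ((J.erase k) ∩ J') *
        Dop d (cP (symmDiff (J.erase k) J')) := by
  have hdd : ∑ k ∈ J, X (MVar.b k) * d (cP (J.erase k)) = 0 := by
    simpa [derivation_cP d ha J, hb] using derivation_derivation_cP d ha hb J
  calc d (cP J) * Dop d (cP J')
      = (∑ k ∈ J, X (MVar.b k) * d (cP (J.erase k))) * cP J' +
          (∑ k ∈ J, X (MVar.b k) * cP (J.erase k)) * Dop d (cP J') := by
        rw [hdd, zero_mul, zero_add, ← derivation_cP d ha]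
    _ = _ := by
        rw [Finset.sum_mul, Finset.sum_mul, ← Finset.sum_add_distrib]
        refine Finset.sum_congr rfl fun k _ => ?_
        rw [mul_assoc _ (PP _), PP_mul_Dop, PP_inter_mul_cP_symmDiff, Dop_mul]
        ring
end

section
/- The kernel of d equals the subring of R generated by the set {θ²} ∪ {x_{2i+1} : 3 ≤ 2i+1 ≤ n} ∪ {x_{2i}² : 2 ≤ 2i ≤ n} ∪ {xₙ} ∪ {d(θᵉ·c_J) : e ∈ {0,1}, J ⊆ {1, …, ⌊(n−1)/2⌋}}. -/
open MvPolynomial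

/-- The variable `x_i` (for `2 ≤ i ≤ n`) of the polynomial ring
`R = 𝔽₂[θ, x₂, …, xₙ]` modelling the mod-2 Chow ring of `BSLₙᶜ`; variables are
indexed by `Option (Fin (n-1))`, with `some ⟨i-2, _⟩` corresponding to `x_i`
and `none` to `θ`. (Outside the range `2 ≤ i ≤ n` we set `x_i = 0`.) -/
noncomputable def xv (n i : ℕ) : MvPolynomial (Option (Fin (n - 1))) (ZMod 2) :=
  if h : 2 ≤ i ∧ i ≤ n then X (some ⟨i - 2, by omega⟩) else 0

/-- The class `θ` of the square-root line bundle `Θ`. -/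
noncomputable def θv (n : ℕ) : MvPolynomial (Option (Fin (n - 1))) (ZMod 2) := X none

/-- `c_J = ∏_{j ∈ J} x_{2j}`, the product of even Chern classes. -/
noncomputable def cv (n : ℕ) (J : Finset ℕ) :
    MvPolynomial (Option (Fin (n - 1))) (ZMod 2) :=
  ∏ j ∈ J, xv n (2 * j)

section Koszul

variable {σ : Type*}

/-- The derivation `∂` with `∂ X_v = X^u` and `∂ X_w = 0` for `w ≠ v`. -/
noncomputable def elemDeriv (v : σ) (u : σ →₀ ℕ) :
    Derivation (ZMod 2) (MvPolynomial σ (ZMod 2)) (MvPolynomial σ (ZMod 2)) :=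
  monomial u (1 : ZMod 2) • pderiv v

open Classical in
/-- The contracting homotopy of `elemDeriv v u`. -/
noncomputable def elemHomotopy (v : σ) (u : σ →₀ ℕ) :
    MvPolynomial σ (ZMod 2) →ₗ[ZMod 2] MvPolynomial σ (ZMod 2) :=
  (basisMonomials σ (ZMod 2)).constr (ZMod 2) fun s =>
    if Even (s v) ∧ u ≤ s then monomial (s + Finsupp.single v 1 - u) 1 else 0

open Classical in
/-- The projection onto the span of the monomials representing the homology of
`elemDeriv v u`. -/
noncomputable def elemProj (v : σ) (u : σ →₀ ℕ) :
    MvPolynomial σ (ZMod 2) →ₗ[ZMod 2] MvPolynomial σ (ZMod 2) :=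
  (basisMonomials σ (ZMod 2)).constr (ZMod 2) fun s =>
    if Even (s v) ∧ ¬ u ≤ s then monomial s 1 else 0

open Classical in
lemma elemHomotopy_monomial (v : σ) (u s : σ →₀ ℕ) :
    elemHomotopy v u (monomial s 1) =
      if Even (s v) ∧ u ≤ s then monomial (s + Finsupp.single v 1 - u) 1 else 0 := by
  have := (basisMonomials σ (ZMod 2)).constr_basis (ZMod 2) (fun s =>
    if Even (s v) ∧ u ≤ s then monomial (s + Finsupp.single v 1 - u) (1 : ZMod 2) else 0) s
  rwa [coe_basisMonomials] at this

open Classical in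
lemma elemProj_monomial (v : σ) (u s : σ →₀ ℕ) :
    elemProj v u (monomial s 1) = if Even (s v) ∧ ¬ u ≤ s then monomial s 1 else 0 := by
  have := (basisMonomials σ (ZMod 2)).constr_basis (ZMod 2) (fun s =>
    if Even (s v) ∧ ¬ u ≤ s then monomial s (1 : ZMod 2) else 0) s
  rwa [coe_basisMonomials] at this

lemma elemDeriv_monomial (v : σ) (u s : σ →₀ ℕ) :
    elemDeriv v u (monomial s 1) =
      if Even (s v) then 0 else monomial (u + (s - Finsupp.single v 1)) 1 := by
  rw [elemDeriv, Derivation.smul_apply, pderiv_monomial, smul_eq_mul, monomial_mul]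
  split_ifs with h
  · rw [(ZMod.natCast_eq_zero_iff_even).2 h]; simp
  · rw [(ZMod.natCast_eq_one_iff_odd).2 (Nat.not_even_iff_odd.1 h)]; simp

lemma elemDeriv_elemHomotopy_add (v : σ) (u : σ →₀ ℕ) (hu : Even (u v))
    (p : MvPolynomial σ (ZMod 2)) :
    elemDeriv v u (elemHomotopy v u p) + elemHomotopy v u (elemDeriv v u p) + elemProj v u p
      = p := by
  classical
  suffices h : (elemDeriv v u).toLinearMap ∘ₗ elemHomotopy v u +
      elemHomotopy v u ∘ₗ (elemDeriv v u).toLinearMap + elemProj v u = LinearMap.id from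
    LinearMap.congr_fun h p
  refine (basisMonomials σ (ZMod 2)).ext fun s => ?_
  simp only [coe_basisMonomials, LinearMap.add_apply, LinearMap.comp_apply,
    Derivation.coeFn_coe, LinearMap.id_apply,
    elemHomotopy_monomial, elemDeriv_monomial, elemProj_monomial]
  by_cases h : Even (s v)
  · by_cases hs : u ≤ s
    · have hv := hs v
      have h1 : ¬ Even ((s + Finsupp.single v 1 - u : σ →₀ ℕ) v) := by
        simp only [Finsupp.tsub_apply, Finsupp.add_apply, Finsupp.single_eq_same]
        grind
      have h2 : u + (s + Finsupp.single v 1 - u - Finsupp.single v 1) = s := by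
        ext i
        have := hs i
        by_cases hi : i = v
        · subst hi; simp; omega
        · simp [hi]; omega
      rw [if_pos ⟨h, hs⟩, elemDeriv_monomial, if_neg h1, h2, if_pos h, if_neg fun h' => h'.2 hs,
        map_zero, add_zero, add_zero]
    · simp [h, hs]
  · have hv : 1 ≤ s v := by
      by_contra h0
      exact h (by rw [show s v = 0 by omega]; exact Even.zero)
    have h1 : Even ((u + (s - Finsupp.single v 1) : σ →₀ ℕ) v) := by
      simp only [Finsupp.tsub_apply, Finsupp.add_apply, Finsupp.single_eq_same]
      grind
    have h2 : u + (s - Finsupp.single v 1) + Finsupp.single v 1 - u = s := by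
      ext i
      by_cases hi : i = v
      · subst hi; simp; omega
      · simp [hi]
    simp only [h, if_false, false_and, map_zero, zero_add, add_zero, elemHomotopy_monomial,
      h1, h2, true_and, le_add_iff_nonneg_right, zero_le, if_true]

lemma elemDeriv_elemHomotopy_comm {v w : σ} {u t : σ →₀ ℕ} (hvw : v ≠ w) (huw : u w = 0)
    (htv : t v = 0) (hut : ∀ i, u i = 0 ∨ t i = 0) (p : MvPolynomial σ (ZMod 2)) :
    elemDeriv w t (elemHomotopy v u p) = elemHomotopy v u (elemDeriv w t p) := by
  classical
  suffices h : (elemDeriv w t).toLinearMap ∘ₗ elemHomotopy v u =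
      elemHomotopy v u ∘ₗ (elemDeriv w t).toLinearMap from LinearMap.congr_fun h p
  refine (basisMonomials σ (ZMod 2)).ext fun s => ?_
  simp only [coe_basisMonomials, LinearMap.comp_apply,
    Derivation.coeFn_coe,
    elemHomotopy_monomial, elemDeriv_monomial]
  have e1 : (s + Finsupp.single v 1 - u : σ →₀ ℕ) w = s w := by simp [huw, hvw.symm]
  have e2 : (t + (s - Finsupp.single w 1) : σ →₀ ℕ) v = s v := by simp [htv, hvw]
  have e3 : u ≤ t + (s - Finsupp.single w 1) ↔ u ≤ s := by
    simp only [Finsupp.le_def]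
    refine forall_congr' fun i => ?_
    by_cases hi : i = w
    · subst hi; simp [huw]
    · rcases hut i with h | h <;> simp [hi, h]
  by_cases hw : Even (s w)
  · by_cases hs : Even (s v) ∧ u ≤ s
    · simp [hw, hs, elemDeriv_monomial, e1]
    · simp [hw, hs]
  · by_cases hs : Even (s v) ∧ u ≤ s
    · rw [if_pos hs, if_neg hw, elemDeriv_monomial, e1, if_neg hw, elemHomotopy_monomial,
        if_pos ⟨e2.symm ▸ hs.1, e3.2 hs.2⟩]
      congr 2
      ext i
      have h1 := hs.2 i
      by_cases hiw : i = w
      · subst hiw; simp [huw, hvw.symm]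
      · by_cases hiv : i = v
        · subst hiv; simp [htv, hvw]
        · rcases hut i with h | h <;> simp [hiw, hiv, h]
    · rw [if_neg hs, if_neg hw, elemHomotopy_monomial,
        if_neg fun h => hs ⟨e2 ▸ h.1, e3.1 h.2⟩, map_zero]

/-- If `d` is a sum of elementary derivations in independent variables, every cycle is
homologous to a combination of monomials of even degree in each differentiated variable. -/
lemma exists_sub_mem_span_even {T : Finset σ} {u : σ → σ →₀ ℕ}
    {d : Derivation (ZMod 2) (MvPolynomial σ (ZMod 2)) (MvPolynomial σ (ZMod 2))}
    (hd : d = ∑ v ∈ T, elemDeriv v (u v)) (hdd : ∀ p, d (d p) = 0)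
    (heven : ∀ v ∈ T, Even (u v v))
    (hoff : ∀ v ∈ T, ∀ w ∈ T, v ≠ w → u v w = 0)
    (hdisj : ∀ v ∈ T, ∀ w ∈ T, v ≠ w → ∀ i, u v i = 0 ∨ u w i = 0)
    {p : MvPolynomial σ (ZMod 2)} (hp : d p = 0) :
    ∃ q, p - d q ∈ Submodule.span (ZMod 2)
      {m | ∃ s : σ →₀ ℕ, (∀ v ∈ T, Even (s v)) ∧ m = monomial s (1 : ZMod 2)} := by
  classical
  have dsum : ∀ x, d x = ∑ v ∈ T, elemDeriv v (u v) x := fun x => by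
    rw [hd, ← Derivation.coeFnAddMonoidHom_apply, map_sum, Finset.sum_apply]
    rfl
  suffices h : ∀ S ⊆ T, ∃ q, p - d q ∈ Submodule.span (ZMod 2)
      {m | ∃ s : σ →₀ ℕ, (∀ v ∈ S, Even (s v)) ∧ m = monomial s (1 : ZMod 2)} from
    h T subset_rfl
  intro S
  induction S using Finset.induction_on with
  | empty =>
    refine fun _ => ⟨0, ?_⟩
    have : {m | ∃ s : σ →₀ ℕ, (∀ v ∈ (∅ : Finset σ), Even (s v)) ∧
        m = monomial s (1 : ZMod 2)} = Set.range (basisMonomials σ (ZMod 2)) := by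
      ext m; simp [eq_comm]
    rw [this, Module.Basis.span_eq]
    trivial
  | insert v S hvS ih =>
    intro hS
    obtain ⟨q, hq⟩ := ih ((Finset.subset_insert _ _).trans hS)
    have hvT : v ∈ T := hS (Finset.mem_insert_self _ _)
    set r := p - d q with hr
    have hdr : d r = 0 := by rw [hr, map_sub, hp, hdd, sub_zero]
    have key : d (elemHomotopy v (u v) r) + elemProj v (u v) r = r := by
      have h1 := elemDeriv_elemHomotopy_add v (u v) (heven v hvT) r
      have h2 : elemHomotopy v (u v) (d r) = 0 := by rw [hdr, map_zero]
      rw [dsum, map_sum, ← Finset.add_sum_erase _ _ hvT] at h2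
      rw [dsum, ← Finset.add_sum_erase _ _ hvT,
        Finset.sum_congr rfl fun w hw => elemDeriv_elemHomotopy_comm
          (Finset.ne_of_mem_erase hw).symm
          (hoff v hvT w (Finset.mem_of_mem_erase hw) (Finset.ne_of_mem_erase hw).symm)
          (hoff w (Finset.mem_of_mem_erase hw) v hvT (Finset.ne_of_mem_erase hw))
          (hdisj v hvT w (Finset.mem_of_mem_erase hw) (Finset.ne_of_mem_erase hw).symm) r]
      rw [eq_neg_of_add_eq_zero_right h2, CharTwo.neg_eq]
      exact h1
    refine ⟨q + elemHomotopy v (u v) r, ?_⟩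
    rw [map_add, ← sub_sub, ← hr, sub_eq_iff_eq_add'.2 key.symm]
    clear_value r
    clear hr hdr key
    induction hq using Submodule.span_induction with
    | mem x hx =>
      obtain ⟨s, hs, rfl⟩ := hx
      rw [elemProj_monomial]
      split_ifs with h
      · refine Submodule.subset_span ⟨s, fun w hw => ?_, rfl⟩
        rcases Finset.mem_insert.1 hw with rfl | hw
        · exact h.1
        · exact hs w hw
      · exact zero_mem _
    | zero => rw [map_zero]; exact zero_mem _
    | add x y _ _ hx hy => rw [map_add]; exact add_mem hx hy
    | smul c x _ hx => rw [map_smul]; exact Submodule.smul_mem _ _ hx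

/-- A derivation of a polynomial ring in characteristic two squares to zero as soon as it does so
on the variables. -/
lemma derivation_sq_eq_zero
    (d : Derivation (ZMod 2) (MvPolynomial σ (ZMod 2)) (MvPolynomial σ (ZMod 2)))
    (h : ∀ i, d (d (X i)) = 0) (p : MvPolynomial σ (ZMod 2)) : d (d p) = 0 := by
  induction p using MvPolynomial.induction_on with
  | C a => rw [derivation_C, map_zero]
  | add p q hp hq => rw [map_add, map_add, hp, hq, add_zero]
  | mul_X p i hp =>
    simp only [Derivation.leibniz, map_add, smul_eq_mul, h, hp, mul_zero, zero_add]
    rw [mul_comm, CharTwo.add_self_eq_zero]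

lemma derivation_pow_two_eq_zero
    (d : Derivation (ZMod 2) (MvPolynomial σ (ZMod 2)) (MvPolynomial σ (ZMod 2)))
    (p : MvPolynomial σ (ZMod 2)) : d (p ^ 2) = 0 := by
  rw [pow_two, Derivation.leibniz, CharTwo.add_self_eq_zero]

end Koszul

lemma xv_add_two {n : ℕ} (i : Fin (n - 1)) : xv n (i + 2) = X (some i) := by
  have := i.2
  rw [xv, dif_pos ⟨by omega, by omega⟩]
  rfl

/-- The kernel of the 𝔽₂-derivation `d` on `R = 𝔽₂[θ, x₂, …, xₙ]` with
`d θ = θ²`, `d x_{2i} = x_{2i+1}` when `2i+1 ≤ n`, `d x_{2i} = 0` when `2i = n`,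
and `d x_j = 0` for odd `j` (modelling `Sq²` on the mod-2 Chow ring of `BSLₙᶜ`)
equals the subring generated by `θ²`, the odd classes `x_{2i+1}`, the squares
`x_{2i}²` of even classes, the top class `xₙ`, and the classes `d(θᵉ·c_J)` for
`e ∈ {0,1}` and `J ⊆ {1, …, ⌊(n−1)/2⌋}`. -/
theorem kernel_sq2_untwisted (n : ℕ) (hn : 2 ≤ n)
    (d : Derivation (ZMod 2) (MvPolynomial (Option (Fin (n - 1))) (ZMod 2))
      (MvPolynomial (Option (Fin (n - 1))) (ZMod 2)))
    (hθ : d (θv n) = θv n ^ 2)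
    (heven : ∀ i : ℕ, 1 ≤ i → 2 * i + 1 ≤ n → d (xv n (2 * i)) = xv n (2 * i + 1))
    (htop : ∀ i : ℕ, 2 * i = n → d (xv n (2 * i)) = 0)
    (hodd : ∀ j : ℕ, Odd j → d (xv n j) = 0) :
    {p | d p = 0} =
      (Subring.closure
        ({θv n ^ 2}
          ∪ {p | ∃ i : ℕ, 3 ≤ 2 * i + 1 ∧ 2 * i + 1 ≤ n ∧ p = xv n (2 * i + 1)}
          ∪ {p | ∃ i : ℕ, 2 ≤ 2 * i ∧ 2 * i ≤ n ∧ p = xv n (2 * i) ^ 2}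
          ∪ {xv n n}
          ∪ {p | ∃ e ≤ 1, ∃ J ⊆ Finset.Icc 1 ((n - 1) / 2),
              p = d (θv n ^ e * cv n J)}) :
        Set (MvPolynomial (Option (Fin (n - 1))) (ZMod 2))) := by
  classical
  set G : Set (MvPolynomial (Option (Fin (n - 1))) (ZMod 2)) := _ ∪ _ with hG
  set K := Subring.closure G with hK
  have mθ : θv n ^ 2 ∈ K := Subring.subset_closure (by simp [hG])
  have modd : ∀ i, 3 ≤ 2 * i + 1 → 2 * i + 1 ≤ n → xv n (2 * i + 1) ∈ K := fun i h1 h2 =>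
    Subring.subset_closure <| Or.inl <| Or.inl <| Or.inl <| Or.inr ⟨i, h1, h2, rfl⟩
  have msq : ∀ i, 2 ≤ 2 * i → 2 * i ≤ n → xv n (2 * i) ^ 2 ∈ K := fun i h1 h2 =>
    Subring.subset_closure <| Or.inl <| Or.inl <| Or.inr ⟨i, h1, h2, rfl⟩
  have mtop : xv n n ∈ K := Subring.subset_closure <| Or.inl <| Or.inr rfl
  have mbd : ∀ e ≤ 1, ∀ J ⊆ Finset.Icc 1 ((n - 1) / 2), d (θv n ^ e * cv n J) ∈ K :=
    fun e he J hJ => Subring.subset_closure <| Or.inr ⟨e, he, J, hJ, rfl⟩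
  have hdd : ∀ p, d (d p) = 0 := by
    refine derivation_sq_eq_zero d fun v => ?_
    rcases v with _ | i
    · change d (d (θv n)) = 0
      rw [hθ, derivation_pow_two_eq_zero]
    · rw [← xv_add_two]
      have hi := i.2
      rcases Nat.even_or_odd' (i : ℕ) with ⟨k, hk | hk⟩
      · rw [show (i : ℕ) + 2 = 2 * (k + 1) by omega]
        by_cases h : 2 * (k + 1) = n
        · rw [htop _ h, map_zero]
        · rw [heven _ (by omega) (by omega), hodd _ (by simp)]
      · rw [hodd _ ⟨k + 1, by omega⟩, map_zero]
  have hker : ∀ p ∈ K, d p = 0 := by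
    intro p hp
    induction hp using Subring.closure_induction with
    | mem x hx =>
      rcases hx with (((rfl | ⟨i, -, -, rfl⟩) | ⟨i, -, -, rfl⟩) | rfl) | ⟨e, -, J, -, rfl⟩
      · exact derivation_pow_two_eq_zero d _
      · exact hodd _ (by simp)
      · exact derivation_pow_two_eq_zero d _
      · rcases Nat.even_or_odd' n with ⟨k, hk | hk⟩
        · have := htop k hk.symm
          rwa [← hk] at this
        · exact hodd _ ⟨k, hk⟩
      · exact hdd _
    | zero => exact map_zero d
    | one => exact d.map_one_eq_zero
    | add x y _ _ hx hy => rw [map_add, hx, hy, add_zero]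
    | neg x _ hx => rw [map_neg, hx, neg_zero]
    | mul x y _ _ hx hy => rw [Derivation.leibniz, hx, hy, smul_zero, smul_zero, add_zero]
  have hC : ∀ a : ZMod 2, (C a : MvPolynomial (Option (Fin (n - 1))) (ZMod 2)) ∈ K := by
    intro a
    fin_cases a
    · exact (C_0 (R := ZMod 2)) ▸ K.zero_mem
    · exact (C_1 (R := ZMod 2)) ▸ K.one_mem
  have hspan : ∀ p, p ∈ Submodule.span K
      {q | ∃ e ≤ 1, ∃ J ⊆ Finset.Icc 1 ((n - 1) / 2), q = θv n ^ e * cv n J} := by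
    intro p
    have hbase : ∀ k ∈ K, ∀ e ≤ 1, ∀ J ⊆ Finset.Icc 1 ((n - 1) / 2),
        k * (θv n ^ e * cv n J) ∈ Submodule.span K
          {q | ∃ e ≤ 1, ∃ J ⊆ Finset.Icc 1 ((n - 1) / 2), q = θv n ^ e * cv n J} :=
      fun k hk e he J hJ => Submodule.smul_mem _ (⟨k, hk⟩ : K)
        (Submodule.subset_span ⟨e, he, J, hJ, rfl⟩)
    induction p using MvPolynomial.induction_on with
    | C a => simpa [cv] using hbase (C a) (hC a) 0 zero_le_one ∅ (Finset.empty_subset _)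
    | add p q hp hq => exact add_mem hp hq
    | mul_X p v hp =>
      induction hp using Submodule.span_induction with
      | zero => rw [zero_mul]; exact zero_mem _
      | add x y _ _ hx hy => rw [add_mul]; exact add_mem hx hy
      | smul k x _ hx => rw [smul_mul_assoc]; exact Submodule.smul_mem _ _ hx
      | mem x hx =>
        obtain ⟨e, he, J, hJ, rfl⟩ := hx
        rcases v with _ | i
        · change _ * θv n ∈ _
          rcases Nat.le_one_iff_eq_zero_or_eq_one.1 he with rfl | rfl
          · convert hbase 1 K.one_mem 1 le_rfl J hJ using 1
            ring
          · convert hbase _ mθ 0 zero_le_one J hJ using 1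
            ring
        · rw [← xv_add_two]
          have hi := i.2
          have of_mem : xv n (i + 2) ∈ K → θv n ^ e * cv n J * xv n (i + 2) ∈ Submodule.span K
              {q | ∃ e ≤ 1, ∃ J ⊆ Finset.Icc 1 ((n - 1) / 2), q = θv n ^ e * cv n J} := by
            intro h
            rw [mul_comm]
            exact hbase _ h e he J hJ
          rcases Nat.even_or_odd' (i : ℕ) with ⟨k, hk | hk⟩
          · by_cases h : (i : ℕ) + 2 = n
            · exact of_mem (by rw [h]; exact mtop)
            · rw [show (i : ℕ) + 2 = 2 * (k + 1) by omega]
              by_cases hkJ : k + 1 ∈ J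
              · convert hbase _ (msq (k + 1) (by omega) (by omega)) e he (J.erase (k + 1))
                  ((Finset.erase_subset _ _).trans hJ) using 1
                rw [cv, ← Finset.mul_prod_erase _ _ hkJ, cv]
                ring
              · convert hbase 1 K.one_mem e he (insert (k + 1) J)
                  (Finset.insert_subset (Finset.mem_Icc.2 ⟨by omega, by omega⟩) hJ) using 1
                rw [cv, cv, Finset.prod_insert hkJ]
                ring
          · refine of_mem ?_
            rw [show (i : ℕ) + 2 = 2 * (k + 1) + 1 by omega]
            exact modd _ (by omega) (by omega)
  have himage : ∀ q, d q ∈ K := by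
    intro q
    induction hspan q using Submodule.span_induction with
    | mem x hx =>
      obtain ⟨e, he, J, hJ, rfl⟩ := hx
      exact mbd e he J hJ
    | zero => rw [map_zero]; exact K.zero_mem
    | add x y _ _ hx hy => rw [map_add]; exact K.add_mem hx hy
    | smul k x _ hx =>
      rw [Subring.smul_def, smul_eq_mul, Derivation.leibniz, hker _ k.2, smul_zero, add_zero]
      exact K.mul_mem k.2 hx
  refine Set.Subset.antisymm (fun p hp => ?_) hker
  let T : Finset (Option (Fin (n - 1))) :=
    Finset.univ.filter fun v => ∀ i ∈ v, Even (i : ℕ) ∧ (i : ℕ) + 1 < n - 1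
  let u : Option (Fin (n - 1)) → Option (Fin (n - 1)) →₀ ℕ := fun v =>
    v.elim (Finsupp.single none 2) fun i =>
      if h : (i : ℕ) + 1 < n - 1 then Finsupp.single (some ⟨i + 1, h⟩) 1 else 0
  have hu : ∀ i : Fin (n - 1), ∀ h : (i : ℕ) + 1 < n - 1,
      u (some i) = Finsupp.single (some ⟨i + 1, h⟩) 1 := fun i h => dif_pos h
  have hT : ∀ i : Fin (n - 1), some i ∈ T ↔ Even (i : ℕ) ∧ (i : ℕ) + 1 < n - 1 := by
    simp [T]
  have hT0 : none ∈ T := by simp [T]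
  have hdT : d = ∑ v ∈ T, elemDeriv v (u v) := by
    refine MvPolynomial.derivation_ext fun w => ?_
    have hsum : (∑ v ∈ T, elemDeriv v (u v)) (X w) =
        if w ∈ T then monomial (u w) 1 else 0 := by
      rw [← Derivation.coeFnAddMonoidHom_apply, map_sum, Finset.sum_apply]
      simp [elemDeriv, pderiv_X, Pi.single_apply, Finset.sum_ite_eq]
    rw [hsum]
    rcases w with _ | i
    · rw [if_pos hT0]
      change d (θv n) = monomial (Finsupp.single none 2) 1
      rw [hθ, θv, X_pow_eq_monomial]
    · rw [← xv_add_two]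
      have hi := i.2
      rcases Nat.even_or_odd' (i : ℕ) with ⟨k, hk | hk⟩
      · by_cases h : (i : ℕ) + 1 < n - 1
        · rw [if_pos ((hT i).2 ⟨⟨k, by omega⟩, h⟩), hu i h,
            show (i : ℕ) + 2 = 2 * (k + 1) by omega, heven _ (by omega) (by omega)]
          have := xv_add_two (n := n) ⟨i + 1, h⟩
          rw [← show (i : ℕ) + 1 + 2 = 2 * (k + 1) + 1 by omega]
          exact this
        · rw [if_neg fun h' => h ((hT i).1 h').2, show (i : ℕ) + 2 = 2 * (k + 1) by omega,
            htop _ (by omega)]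
      · rw [if_neg fun h' => by
          have := ((hT i).1 h').1
          grind, hodd _ ⟨k + 1, by omega⟩]
  obtain ⟨q, hq⟩ := exists_sub_mem_span_even hdT hdd
    (by
      rintro (_ | i) hv
      · simp [u]
      · rw [hu i ((hT i).1 hv).2, Finsupp.single_apply]
        simp [Fin.ext_iff])
    (by
      rintro (_ | i) hv (_ | j) hw hvw
      · exact absurd rfl hvw
      · simp [u]
      · rw [hu i ((hT i).1 hv).2]; simp
      · rw [hu i ((hT i).1 hv).2, Finsupp.single_apply, if_neg]
        have h1 := ((hT i).1 hv).1
        have h2 := ((hT j).1 hw).1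
        simp only [Option.some.injEq, Fin.ext_iff]
        grind)
    (by
      rintro (_ | i) hv (_ | j) hw hvw l
      · exact absurd rfl hvw
      · rw [hu j ((hT j).1 hw).2]
        rcases l with _ | l <;> simp [u]
      · rw [hu i ((hT i).1 hv).2]
        rcases l with _ | l <;> simp [u]
      · rw [hu i ((hT i).1 hv).2, hu j ((hT j).1 hw).2]
        have h3 : (i : ℕ) ≠ j := fun h => hvw (by rw [Fin.ext h])
        rcases l with _ | l
        · simp
        · simp only [Finsupp.single_apply, Option.some.injEq, Fin.ext_iff]
          grind)
    (show d p = 0 from hp)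
  suffices h : p - d q ∈ K by simpa using K.add_mem h (himage q)
  generalize p - d q = r at hq
  induction hq using Submodule.span_induction with
  | zero => exact K.zero_mem
  | add x y _ _ hx hy => exact K.add_mem hx hy
  | smul c x _ hx =>
    rw [smul_eq_C_mul]
    exact K.mul_mem (hC c) hx
  | mem x hx =>
    obtain ⟨s, hs, rfl⟩ := hx
    rw [monomial_eq, C_1, one_mul]
    refine K.prod_mem fun v _ => ?_
    beta_reduce
    rcases v with _ | i
    · obtain ⟨k, hk⟩ := hs _ hT0
      rw [hk, ← two_mul, pow_mul]
      exact K.pow_mem mθ k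
    · rw [← xv_add_two]
      have hi := i.2
      rcases Nat.even_or_odd' (i : ℕ) with ⟨k, hk | hk⟩
      · by_cases h : (i : ℕ) + 2 = n
        · rw [h]
          exact K.pow_mem mtop _
        · obtain ⟨l, hl⟩ := hs _ ((hT i).2 ⟨⟨k, by omega⟩, by omega⟩)
          rw [hl, ← two_mul, pow_mul, show (i : ℕ) + 2 = 2 * (k + 1) by omega]
          exact K.pow_mem (msq _ (by omega) (by omega)) l
      · rw [show (i : ℕ) + 2 = 2 * (k + 1) + 1 by omega]
        exact K.pow_mem (modd _ (by omega) (by omega)) _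
end

section
/- The kernel of D, i.e. the set {p ∈ R : d(p) = θ·p}, equals the set of all finite sums Σ_J k_J · D(c_J), where J ranges over the subsets of {1, …, ⌊(n−1)/2⌋} (including J = ∅, for which D(c_∅) = θ) and each coefficient k_J lies in the kernel of d. Equivalently, ker D is the (ker d)-submodule of R generated by the elements D(c_J). -/
open MvPolynomial

/-- The constants common to two derivations, as a subalgebra. -/
def commonConstants {k R : Type*} [CommRing k] [CommRing R] [Algebra k R]
    (d e : Derivation k R R) : Subalgebra k R where
  carrier := {q | d q = 0 ∧ e q = 0}
  mul_mem' := by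
    rintro a b ⟨h1, h2⟩ ⟨h3, h4⟩
    simp [h1, h2, h3, h4]
  add_mem' := by
    rintro a b ⟨h1, h2⟩ ⟨h3, h4⟩
    simp [h1, h2, h3, h4]
  algebraMap_mem' r := by simp

section Derivation

variable {k R : Type*} [CommRing k] [CommRing R] [Algebra k R]

theorem derivation_sq_eq_zero_s8 [CharP R 2] (d : Derivation k R R) (q : R) : d (q ^ 2) = 0 := by
  rw [sq, Derivation.leibniz, CharTwo.add_self_eq_zero]

theorem derivation_prod_eq_zero {ι : Type*} (e : Derivation k R R) (s : Finset ι) (f : ι → R)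
    (h : ∀ i ∈ s, e (f i) = 0) : e (∏ i ∈ s, f i) = 0 := by
  refine Finset.prod_induction f (fun q => e q = 0) (fun a b ha hb => ?_) (by simp) h
  simp [ha, hb]

theorem derivation_derivation_prod_eq_zero {ι : Type*} (d e : Derivation k R R) (s : Finset ι)
    (f : ι → R) (h : ∀ i ∈ s, e (f i) = 0) (h' : ∀ i ∈ s, e (d (f i)) = 0) :
    e (d (∏ i ∈ s, f i)) = 0 := by
  refine (Finset.prod_induction f (fun q => e q = 0 ∧ e (d q) = 0) (fun a b ha hb => ?_)
    (by simp) fun i hi => ⟨h i hi, h' i hi⟩).2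
  simp [ha.1, ha.2, hb.1, hb.2]

theorem derivation_sq_prod_eq_zero [CharP R 2] {ι : Type*} (d : Derivation k R R) (s : Finset ι)
    (f : ι → R) (h : ∀ i ∈ s, d (d (f i)) = 0) : d (d (∏ i ∈ s, f i)) = 0 := by
  refine Finset.prod_induction f (fun q => d (d q) = 0) (fun a b ha hb => ?_) (by simp) h
  simp only [Derivation.leibniz, map_add, smul_eq_mul, ha, hb]
  linear_combination d a * d b * CharTwo.two_eq_zero (R := R)

/-- If every generator `x j`, `j ∈ s`, has its square in the subalgebra `A`, then the `A`-span of
the squarefree monomials in the `x j` is stable under multiplication by each `x j`. -/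
theorem mul_mem_span_squarefree {ι : Type*} [DecidableEq ι] (A : Subalgebra k R) (x : ι → R)
    (s : Finset ι) {j : ι} (hj : j ∈ s) (hx : x j ^ 2 ∈ A) {q : R}
    (hq : q ∈ Submodule.span A ((fun J => ∏ i ∈ J, x i) '' (s.powerset : Set (Finset ι)))) :
    x j * q ∈ Submodule.span A ((fun J => ∏ i ∈ J, x i) '' (s.powerset : Set (Finset ι))) := by
  induction hq using Submodule.span_induction with
  | mem q hq =>
    obtain ⟨J, hJ, rfl⟩ := hq
    have hJ' : J ⊆ s := by simpa using hJ
    by_cases h : j ∈ J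
    · have e : x j * ∏ i ∈ J, x i = (⟨x j ^ 2, hx⟩ : A) • ∏ i ∈ J.erase j, x i := by
        rw [← Finset.mul_prod_erase J x h, Subalgebra.smul_def, smul_eq_mul]
        ring
      simp only [e]
      refine Submodule.smul_mem _ _ (Submodule.subset_span ⟨J.erase j, ?_, rfl⟩)
      exact Finset.mem_coe.2 (Finset.mem_powerset.2 ((Finset.erase_subset j J).trans hJ'))
    · refine Submodule.subset_span ⟨insert j J, ?_, Finset.prod_insert h⟩
      exact Finset.mem_coe.2 (Finset.mem_powerset.2 (Finset.insert_subset hj hJ'))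
  | zero => simp
  | add a b _ _ ha hb => rw [mul_add]; exact add_mem ha hb
  | smul a q _ h => rw [mul_smul_comm]; exact Submodule.smul_mem _ _ h

end Derivation

/-- An additive subgroup `N` that contains the constants and is stable under multiplication by the
square of the variable `t = X none` and by all the other variables satisfies `N + t N = ⊤`. -/
theorem MvPolynomial.exists_eq_add_mul_of_stable {σ F : Type*} [CommRing F]
    (N : AddSubgroup (MvPolynomial (Option σ) F)) (h1 : ∀ r, C r ∈ N)
    (hN : ∀ i, ∀ q ∈ N, X (some i) * q ∈ N) (ht : ∀ q ∈ N, X none ^ 2 * q ∈ N)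
    (p : MvPolynomial (Option σ) F) : ∃ a ∈ N, ∃ b ∈ N, p = a + X none * b := by
  induction p using MvPolynomial.induction_on with
  | C r => exact ⟨C r, h1 r, 0, zero_mem N, by simp⟩
  | add p q hp hq =>
    obtain ⟨a, ha, b, hb, rfl⟩ := hp
    obtain ⟨a', ha', b', hb', rfl⟩ := hq
    exact ⟨a + a', add_mem ha ha', b + b', add_mem hb hb', by ring⟩
  | mul_X p i hp =>
    obtain ⟨a, ha, b, hb, rfl⟩ := hp
    rcases i with _ | i
    · exact ⟨_, ht b hb, a, ha, by ring⟩
    · exact ⟨_, hN i a ha, _, hN i b hb, by ring⟩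

theorem pderiv_none_xv (n i : ℕ) : pderiv none (xv n i) = 0 := by
  unfold xv
  split_ifs
  · exact pderiv_X_of_ne (by simp)
  · simp

theorem X_some_eq_xv (n : ℕ) (m : Fin (n - 1)) :
    (X (some m) : MvPolynomial (Option (Fin (n - 1))) (ZMod 2)) = xv n (m + 2) := by
  have := m.2
  rw [xv, dif_pos (by omega)]
  rfl

/-- The kernel of the twisted operation `D(p) = d(p) + θ·p` (modelling `Sq²_Θ`),
i.e. `{p : d p = θ·p}`, equals the set of finite sums `Σ_J k_J · D(c_J)` where
`J` ranges over the subsets of `{1, …, ⌊(n−1)/2⌋}` (including `J = ∅`, with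
`D(c_∅) = θ`) and each coefficient `k_J` lies in `ker d`; that is, `ker D` is
the `(ker d)`-submodule of `R` generated by the elements `D(c_J)`. Here `d` is
the 𝔽₂-derivation on `R = 𝔽₂[θ, x₂, …, xₙ]` with `d θ = θ²`,
`d x_{2i} = x_{2i+1}` when `2i+1 ≤ n`, `d x_{2i} = 0` when `2i = n`, and
`d x_j = 0` for odd `j`. -/
theorem kernel_sq2_twisted (n : ℕ) (hn : 2 ≤ n)
    (d : Derivation (ZMod 2) (MvPolynomial (Option (Fin (n - 1))) (ZMod 2))
      (MvPolynomial (Option (Fin (n - 1))) (ZMod 2)))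
    (hθ : d (θv n) = θv n ^ 2)
    (heven : ∀ i : ℕ, 1 ≤ i → 2 * i + 1 ≤ n → d (xv n (2 * i)) = xv n (2 * i + 1))
    (htop : ∀ i : ℕ, 2 * i = n → d (xv n (2 * i)) = 0)
    (hodd : ∀ j : ℕ, Odd j → d (xv n j) = 0) :
    {p | d p = θv n * p} =
      {q : MvPolynomial (Option (Fin (n - 1))) (ZMod 2) |
        ∃ k : Finset ℕ → MvPolynomial (Option (Fin (n - 1))) (ZMod 2),
          (∀ J, d (k J) = 0) ∧
            q = ∑ J ∈ (Finset.Icc 1 ((n - 1) / 2)).powerset,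
              k J * (d (cv n J) + θv n * cv n J)} := by
  have hE : ∀ j ∈ Finset.Icc 1 ((n - 1) / 2), d (xv n (2 * j)) = xv n (2 * j + 1) := by
    intro j hj
    rw [Finset.mem_Icc] at hj
    exact heven j hj.1 (by omega)
  have hdd : ∀ J ∈ (Finset.Icc 1 ((n - 1) / 2)).powerset, d (d (cv n J)) = 0 := by
    intro J hJ
    refine derivation_sq_prod_eq_zero d J _ fun j hj => ?_
    rw [hE j (Finset.mem_powerset.1 hJ hj)]
    exact hodd _ (odd_two_mul_add_one j)
  have hc : ∀ J, pderiv none (cv n J) = 0 := fun J =>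
    derivation_prod_eq_zero _ J _ fun j _ => pderiv_none_xv n _
  have hdc : ∀ J ∈ (Finset.Icc 1 ((n - 1) / 2)).powerset, pderiv none (d (cv n J)) = 0 := by
    intro J hJ
    refine derivation_derivation_prod_eq_zero d _ J _ (fun j _ => pderiv_none_xv n _)
      fun j hj => ?_
    rw [hE j (Finset.mem_powerset.1 hJ hj)]
    exact pderiv_none_xv n _
  ext p
  simp only [Set.mem_ofPred_eq]
  constructor
  · intro hp
    let A := commonConstants d (pderiv none)
    let N := Submodule.span A
      (cv n '' ((Finset.Icc 1 ((n - 1) / 2)).powerset : Set (Finset ℕ)))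
    have hA : ∀ a ∈ A, ∀ q ∈ N, a * q ∈ N := fun a ha q hq => N.smul_mem ⟨a, ha⟩ hq
    have hone : (1 : MvPolynomial (Option (Fin (n - 1))) (ZMod 2)) ∈ N :=
      Submodule.subset_span ⟨∅, by simp, by simp [cv]⟩
    have hX : ∀ i, ∀ q ∈ N, X (some i) * q ∈ N := by
      intro m q hq
      have hm := m.2
      rw [X_some_eq_xv]
      rcases Nat.even_or_odd' (m + 2 : ℕ) with ⟨j, hj | hj⟩
      · rw [hj]
        by_cases hjn : 2 * j = n
        · exact hA _ ⟨htop j hjn, pderiv_none_xv n _⟩ q hq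
        · exact mul_mem_span_squarefree A (fun j => xv n (2 * j)) _
            (Finset.mem_Icc.2 ⟨by omega, by omega⟩)
            ⟨derivation_sq_eq_zero_s8 _ _, derivation_sq_eq_zero_s8 _ _⟩ hq
      · rw [hj]
        exact hA _ ⟨hodd _ (odd_two_mul_add_one j), pderiv_none_xv n _⟩ q hq
    obtain ⟨a, ha, b, hb, rfl⟩ := MvPolynomial.exists_eq_add_mul_of_stable N.toAddSubgroup
      (fun r => by simpa using hA (C r) (A.algebraMap_mem r) 1 hone) hX
      (hA _ ⟨derivation_sq_eq_zero_s8 _ _, derivation_sq_eq_zero_s8 _ _⟩) p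
    have hN : ∀ q ∈ N, pderiv none q = 0 ∧ pderiv none (d q) = 0 := by
      intro q hq
      induction hq using Submodule.span_induction with
      | mem q hq =>
        obtain ⟨J, hJ, rfl⟩ := hq
        exact ⟨hc J, hdc J hJ⟩
      | zero => simp
      | add a b _ _ ha hb => simp [ha.1, ha.2, hb.1, hb.2]
      | smul a q _ h =>
        have h1 := a.2.1
        have h2 := a.2.2
        simp [Subalgebra.smul_def, h1, h2, h.1, h.2]
    have hab : a = d b := by
      have h : d a + θv n * (a + d b) = 0 := by
        rw [map_add, Derivation.leibniz, ← θv, hθ, smul_eq_mul, smul_eq_mul] at hp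
        linear_combination hp + θv n * a * CharTwo.two_eq_zero
          (R := MvPolynomial (Option (Fin (n - 1))) (ZMod 2))
      have h' := congrArg (pderiv none) h
      rw [map_add, (hN a ha).2, Derivation.leibniz, map_add, (hN a ha).1, (hN b hb).2, θv,
        pderiv_X_self] at h'
      exact CharTwo.add_eq_zero.1 (by simpa using h')
    obtain ⟨c, rfl⟩ := (Submodule.mem_span_image_finset_iff_exists_fun' _).1 hb
    refine ⟨fun J => c J, fun J => (c J).2.1, ?_⟩
    rw [hab, ← θv, map_sum, Finset.mul_sum, ← Finset.sum_add_distrib]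
    refine Finset.sum_congr rfl fun J _ => ?_
    have h := (c J).2.1
    simp only [Subalgebra.smul_def, smul_eq_mul, Derivation.leibniz, h]
    ring
  · rintro ⟨k, hk, rfl⟩
    rw [map_sum, Finset.mul_sum]
    refine Finset.sum_congr rfl fun J hJ => ?_
    simp only [Derivation.leibniz, map_add, smul_eq_mul, hk, hdd J hJ, hθ]
    ring
end

section
/- The kernel of d equals the subring of R generated by the set {x_{2i+1} : 3 ≤ 2i+1 ≤ n} ∪ {x_{2i}² : 2 ≤ 2i ≤ n} ∪ {xₙ} ∪ {d(x_{2j₁}·x_{2j₂}·…·x_{2j_l}) : 0 < j₁ < … < j_l ≤ ⌊(n−1)/2⌋}. -/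
open MvPolynomial

/-- The variable `x_i` (for `2 ≤ i ≤ n`) of the polynomial ring
`R = 𝔽₂[x₂, …, xₙ]` modelling the mod-2 Chow ring of `BSLₙ`; variables are
indexed by `Fin (n-1)`, with `⟨i-2, _⟩` corresponding to `x_i`.
(Outside the range `2 ≤ i ≤ n` we set `x_i = 0`.) -/
noncomputable def yv (n i : ℕ) : MvPolynomial (Fin (n - 1)) (ZMod 2) :=
  if h : 2 ≤ i ∧ i ≤ n then X ⟨i - 2, by omega⟩ else 0

section Koszul

variable {σ : Type*} {D : Derivation (ZMod 2) (MvPolynomial σ (ZMod 2)) (MvPolynomial σ (ZMod 2))}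

/-- In characteristic two, the square of a derivation is determined by its values on variables. -/
theorem derivation_sq_eq_zero_s10 (hD : ∀ c, D (D (X c)) = 0) (p : MvPolynomial σ (ZMod 2)) :
    D (D p) = 0 := by
  induction p using MvPolynomial.induction_on with
  | C r => simp [← MvPolynomial.algebraMap_eq]
  | add p q hp hq => simp [hp, hq]
  | mul_X p c hp =>
    simp only [Derivation.leibniz, map_add, smul_eq_mul, hD, hp, mul_zero, zero_add]
    rw [mul_comm (D (X c))]
    exact CharTwo.add_self_eq_zero _

variable (a b : σ)

open Classical in
/-- The homotopy `a ^ (2k) * b ^ (j+1) ↦ a ^ (2k+1) * b ^ j`, linear in the other variables. -/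
noncomputable def homotopy : MvPolynomial σ (ZMod 2) →ₗ[ZMod 2] MvPolynomial σ (ZMod 2) :=
  (basisMonomials σ (ZMod 2)).constr (ZMod 2) fun s =>
    if Even (s a) ∧ s b ≠ 0 then
      monomial (s + Finsupp.single a 1 - Finsupp.single b 1) 1 else 0

open Classical in
/-- The projection onto the monomials of even degree in `a` and of degree zero in `b`. -/
noncomputable def evenProj : MvPolynomial σ (ZMod 2) →ₗ[ZMod 2] MvPolynomial σ (ZMod 2) :=
  (basisMonomials σ (ZMod 2)).constr (ZMod 2) fun s =>
    if Even (s a) ∧ s b = 0 then monomial s 1 else 0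

open Classical in
theorem homotopy_monomial (s : σ →₀ ℕ) :
    homotopy a b (monomial s 1) = if Even (s a) ∧ s b ≠ 0 then
      monomial (s + Finsupp.single a 1 - Finsupp.single b 1) 1 else 0 := by
  simpa only [homotopy, coe_basisMonomials] using (basisMonomials σ (ZMod 2)).constr_basis (ZMod 2) _ s

open Classical in
theorem evenProj_monomial (s : σ →₀ ℕ) :
    evenProj a b (monomial s 1) = if Even (s a) ∧ s b = 0 then monomial s 1 else 0 := by
  simpa only [evenProj, coe_basisMonomials] using (basisMonomials σ (ZMod 2)).constr_basis (ZMod 2) _ s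

open Classical in
theorem coeff_evenProj (s : σ →₀ ℕ) (p : MvPolynomial σ (ZMod 2)) :
    coeff s (evenProj a b p) = if Even (s a) ∧ s b = 0 then coeff s p else 0 := by
  induction p using MvPolynomial.induction_on' with
  | monomial t r =>
    rw [← mul_one r, ← smul_eq_mul, ← smul_monomial, map_smul, evenProj_monomial]
    by_cases h : t = s
    · subst h; split_ifs <;> simp
    · split_ifs <;> simp [coeff_monomial, h]
  | add p q hp hq =>
    rw [map_add, coeff_add, hp, hq, coeff_add]
    split_ifs <;> simp

variable {a b}

theorem homotopy_X_mul {c : σ} (ha : c ≠ a) (hb : c ≠ b) (p : MvPolynomial σ (ZMod 2)) :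
    homotopy a b (X c * p) = X c * homotopy a b p := by
  have key : homotopy a b ∘ₗ LinearMap.mulLeft (ZMod 2) (X c) =
      LinearMap.mulLeft (ZMod 2) (X c) ∘ₗ homotopy a b := by
    refine (basisMonomials σ (ZMod 2)).ext fun s => ?_
    simp only [coe_basisMonomials, LinearMap.comp_apply, LinearMap.mulLeft_apply]
    rw [X, monomial_mul, one_mul, homotopy_monomial, homotopy_monomial]
    simp only [Finsupp.add_apply, Finsupp.single_eq_of_ne ha.symm, Finsupp.single_eq_of_ne hb.symm,
      zero_add]
    split_ifs with h
    · rw [monomial_mul, one_mul]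
      congr 2
      have : Finsupp.single b 1 ≤ s + Finsupp.single a 1 := by
        refine le_trans ?_ le_self_add
        rw [Finsupp.single_le_iff]
        omega
      rw [add_assoc, add_tsub_assoc_of_le this]
    · simp
  exact LinearMap.congr_fun key p

theorem homotopy_mul_of_mem_supported {u : MvPolynomial σ (ZMod 2)}
    (hu : u ∈ supported (ZMod 2) ({a, b}ᶜ : Set σ)) (p : MvPolynomial σ (ZMod 2)) :
    homotopy a b (u * p) = u * homotopy a b p := by
  rw [supported] at hu
  induction hu using Algebra.adjoin_induction generalizing p with
  | mem x hx =>
    obtain ⟨c, hc, rfl⟩ := hx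
    simp only [Set.mem_compl_iff, Set.mem_insert_iff, Set.mem_singleton_iff, not_or] at hc
    exact homotopy_X_mul hc.1 hc.2 p
  | algebraMap r => rw [← Algebra.smul_def, map_smul, Algebra.smul_def]
  | add x y _ _ hx hy => simp [add_mul, hx, hy]
  | mul x y _ _ hx hy => simp [mul_assoc, hx, hy]

theorem derivation_mem_supported {t : Set σ} (ht : ∀ c ∈ t, D (X c) ∈ supported (ZMod 2) t)
    {u : MvPolynomial σ (ZMod 2)} (hu : u ∈ supported (ZMod 2) t) :
    D u ∈ supported (ZMod 2) t := by
  have hu' := hu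
  rw [supported] at hu'
  induction hu' using Algebra.adjoin_induction with
  | mem x hx => obtain ⟨c, hc, rfl⟩ := hx; exact ht c hc
  | algebraMap r => simp
  | add x y hx hy h h' => rw [map_add]; exact add_mem (h hx) (h' hy)
  | mul x y hx hy h h' =>
    rw [Derivation.leibniz]
    exact add_mem (mul_mem hx (h' hy)) (mul_mem hy (h hx))

theorem X_pow_mul_X_pow (i j : ℕ) : (X a ^ i * X b ^ j : MvPolynomial σ (ZMod 2)) =
    monomial (Finsupp.single a i + Finsupp.single b j) 1 := by
  rw [X_pow_eq_monomial, X_pow_eq_monomial, monomial_mul, one_mul]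

theorem homotopy_even (hab : a ≠ b) (k j : ℕ) :
    homotopy a b (X a ^ (2 * k) * X b ^ (j + 1)) = X a ^ (2 * k + 1) * X b ^ j := by
  rw [X_pow_mul_X_pow, X_pow_mul_X_pow, homotopy_monomial, if_pos]
  · congr 2
    rw [Finsupp.single_add, Finsupp.single_add]
    rw [← add_assoc, add_right_comm _ (Finsupp.single b 1), add_tsub_cancel_right]
    abel
  · simp [hab, hab.symm]

theorem homotopy_even_zero (hab : a ≠ b) (k : ℕ) :
    homotopy a b (X a ^ (2 * k) * X b ^ 0) = 0 := by
  rw [X_pow_mul_X_pow, homotopy_monomial, if_neg]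
  simp [hab]

theorem homotopy_odd (hab : a ≠ b) (k j : ℕ) :
    homotopy a b (X a ^ (2 * k + 1) * X b ^ j) = 0 := by
  rw [X_pow_mul_X_pow, homotopy_monomial, if_neg]
  simp [hab.symm]

theorem derivation_pow_mul_pow (ha : D (X a) = X b) (hb : D (X b) = 0) (i j : ℕ) :
    D (X a ^ i * X b ^ j) = (i : MvPolynomial σ (ZMod 2)) * (X a ^ (i - 1) * X b ^ (j + 1)) := by
  rw [Derivation.leibniz, Derivation.leibniz_pow, Derivation.leibniz_pow, ha, hb]
  simp only [smul_eq_mul, nsmul_eq_mul]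
  ring

theorem homotopy_formula_aux (hab : a ≠ b) (ha : D (X a) = X b) (hb : D (X b) = 0) (i j : ℕ) :
    X a ^ i * X b ^ j = D (homotopy a b (X a ^ i * X b ^ j)) +
      homotopy a b (D (X a ^ i * X b ^ j)) + if Even i ∧ j = 0 then X a ^ i * X b ^ j else 0 := by
  rw [derivation_pow_mul_pow ha hb]
  rcases Nat.even_or_odd' i with ⟨k, rfl | rfl⟩
  · have h0 : ((2 * k : ℕ) : MvPolynomial σ (ZMod 2)) = 0 := by
      rw [Nat.cast_mul, Nat.cast_two, CharTwo.two_eq_zero (R := MvPolynomial σ (ZMod 2)), zero_mul]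
    rcases j with _ | j
    · rw [homotopy_even_zero hab, h0]; simp
    · rw [homotopy_even hab, h0, derivation_pow_mul_pow ha hb, Nat.cast_add, h0]; simp
  · have h1 : ((2 * k + 1 : ℕ) : MvPolynomial σ (ZMod 2)) = 1 := by
      rw [Nat.cast_add, Nat.cast_mul, Nat.cast_two,
        CharTwo.two_eq_zero (R := MvPolynomial σ (ZMod 2)), zero_mul, zero_add, Nat.cast_one]
    rw [h1, one_mul, add_tsub_cancel_right, homotopy_odd hab, homotopy_even hab]
    simp

theorem homotopy_formula (hab : a ≠ b) (ha : D (X a) = X b) (hb : D (X b) = 0)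
    (hc : ∀ c ∈ ({a, b}ᶜ : Set σ), D (X c) ∈ supported (ZMod 2) ({a, b}ᶜ : Set σ))
    (p : MvPolynomial σ (ZMod 2)) :
    p = D (homotopy a b p) + homotopy a b (D p) + evenProj a b p := by
  have key : LinearMap.id = D.toLinearMap ∘ₗ homotopy a b + homotopy a b ∘ₗ D.toLinearMap +
      evenProj a b := by
    refine (basisMonomials σ (ZMod 2)).ext fun s => ?_
    simp only [coe_basisMonomials, LinearMap.comp_apply, LinearMap.add_apply, LinearMap.id_apply,
      Derivation.coeFn_coe]
    set t := (s.erase a).erase b with ht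
    set u : MvPolynomial σ (ZMod 2) := monomial t 1 with hu
    have hs : monomial s 1 = u * (X a ^ s a * X b ^ s b) := by
      have : s = t + (Finsupp.single a (s a) + Finsupp.single b (s b)) := by
        rw [ht, add_comm (Finsupp.single a (s a)), ← add_assoc]
        conv_lhs => rw [← Finsupp.erase_add_single a s, ← Finsupp.erase_add_single b (s.erase a)]
        rw [Finsupp.erase_ne hab.symm]
      rw [X_pow_mul_X_pow, hu, monomial_mul, one_mul, ← this]
    have hmem : u ∈ supported (ZMod 2) ({a, b}ᶜ : Set σ) := by
      classical
      rw [mem_supported, hu, vars_monomial one_ne_zero]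
      intro c hc'
      simp only [ht, Finsupp.support_erase, Finset.coe_erase, Set.mem_sdiff] at hc'
      simp only [Set.mem_compl_iff, Set.mem_insert_iff, Set.mem_singleton_iff] at hc' ⊢
      tauto
    rw [evenProj_monomial, hs, homotopy_mul_of_mem_supported hmem, Derivation.leibniz,
      Derivation.leibniz, map_add, smul_eq_mul, smul_eq_mul, smul_eq_mul, smul_eq_mul,
      homotopy_mul_of_mem_supported hmem, mul_comm (X a ^ s a * X b ^ s b) (D u),
      homotopy_mul_of_mem_supported (derivation_mem_supported hc hmem)]
    have h := congr_arg (u * ·) (homotopy_formula_aux hab ha hb (s a) (s b))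
    simp only [mul_add, mul_ite, mul_zero] at h
    rw [mul_comm (homotopy a b _) (D u)]
    have h2 := CharTwo.add_self_eq_zero (D u * homotopy a b (X a ^ s a * X b ^ s b))
    convert h using 1
    linear_combination h2
  exact LinearMap.congr_fun key p

/-- A cocycle is cohomologous to one only involving even powers of the variable `a`. -/
theorem exists_eq_derivation_add_even (hab : a ≠ b) (ha : D (X a) = X b) (hb : D (X b) = 0)
    (hc : ∀ c ∈ ({a, b}ᶜ : Set σ), D (X c) ∈ supported (ZMod 2) ({a, b}ᶜ : Set σ))
    {p : MvPolynomial σ (ZMod 2)} (hp : D p = 0) :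
    ∃ q r, p = D q + r ∧ r.support ⊆ p.support ∧ ∀ s ∈ r.support, Even (s a) := by
  refine ⟨homotopy a b p, evenProj a b p, ?_, ?_, ?_⟩
  · have h := homotopy_formula hab ha hb hc p
    rwa [hp, map_zero, add_zero] at h
  all_goals
    intro s hs
    rw [mem_support_iff, coeff_evenProj] at hs
    split_ifs at hs with h
  · exact mem_support_iff.2 hs
  · exact absurd rfl hs
  · exact h.1
  · exact absurd rfl hs

end Koszul

theorem yv_eq_X {n i : ℕ} (h : 2 ≤ i) (h' : i ≤ n) :
    yv n i = X (⟨i - 2, by omega⟩ : Fin (n - 1)) := dif_pos ⟨h, h'⟩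

theorem X_eq_yv {n : ℕ} (c : Fin (n - 1)) : (X c : MvPolynomial _ (ZMod 2)) = yv n (c + 2) := by
  rw [yv_eq_X (by omega) (by omega)]
  rfl

/-- The kernel of the 𝔽₂-derivation `d` on `R = 𝔽₂[x₂, …, xₙ]` with
`d x_{2i} = x_{2i+1}` when `2i+1 ≤ n`, `d x_{2i} = 0` when `2i = n`, and
`d x_j = 0` for odd `j` (modelling `Sq²` on the mod-2 Chow ring of `BSLₙ`)
equals the subring generated by the odd classes `x_{2i+1}`, the squares
`x_{2i}²` of even classes, the top class `xₙ`, and the Steenrod squares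
`d(x_{2j₁}·…·x_{2j_l})` of products of even classes with
`0 < j₁ < … < j_l ≤ ⌊(n−1)/2⌋`. -/
theorem kernel_sq2_bsln (n : ℕ) (hn : 2 ≤ n)
    (d : Derivation (ZMod 2) (MvPolynomial (Fin (n - 1)) (ZMod 2))
      (MvPolynomial (Fin (n - 1)) (ZMod 2)))
    (heven : ∀ i : ℕ, 1 ≤ i → 2 * i + 1 ≤ n → d (yv n (2 * i)) = yv n (2 * i + 1))
    (htop : ∀ i : ℕ, 2 * i = n → d (yv n (2 * i)) = 0)
    (hodd : ∀ j : ℕ, Odd j → d (yv n j) = 0) :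
    {p | d p = 0} =
      (Subring.closure
        ({p | ∃ i : ℕ, 3 ≤ 2 * i + 1 ∧ 2 * i + 1 ≤ n ∧ p = yv n (2 * i + 1)}
          ∪ {p | ∃ i : ℕ, 2 ≤ 2 * i ∧ 2 * i ≤ n ∧ p = yv n (2 * i) ^ 2}
          ∪ {yv n n}
          ∪ {p | ∃ J : Finset ℕ, J.Nonempty ∧ J ⊆ Finset.Icc 1 ((n - 1) / 2) ∧
              p = d (∏ j ∈ J, yv n (2 * j))}) :
        Set (MvPolynomial (Fin (n - 1)) (ZMod 2))) := by
  have hcases : ∀ c : Fin (n - 1), (∃ i, 3 ≤ 2 * i + 1 ∧ 2 * i + 1 ≤ n ∧ X c = yv n (2 * i + 1)) ∨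
      (X c = yv n n) ∨
      (∃ i, 1 ≤ i ∧ 2 * i + 1 ≤ n ∧ (c : ℕ) + 2 = 2 * i ∧ X c = yv n (2 * i)) := by
    intro c
    rw [X_eq_yv]
    have := c.2
    rcases Nat.even_or_odd' ((c : ℕ) + 2) with ⟨i, hi | hi⟩
    · by_cases h : 2 * i = n
      · exact Or.inr (Or.inl (by rw [hi, h]))
      · exact Or.inr (Or.inr ⟨i, by omega, by omega, hi, by rw [hi]⟩)
    · exact Or.inl ⟨i, by omega, by omega, by rw [hi]⟩
  have hdn : d (yv n n) = 0 := by
    rcases Nat.even_or_odd' n with ⟨i, hi | hi⟩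
    · have := htop i hi.symm
      rwa [← hi] at this
    · exact hodd n ⟨i, hi⟩
  have hdd : ∀ p, d (d p) = 0 := derivation_sq_eq_zero_s10 fun c => by
    rcases hcases c with ⟨i, -, -, h⟩ | h | ⟨i, h1, h2, -, h⟩
    · rw [h, hodd _ ⟨i, rfl⟩, map_zero]
    · rw [h, hdn, map_zero]
    · rw [h, heven i h1 h2, hodd _ ⟨i, rfl⟩]
  set G := ({p | ∃ i : ℕ, 3 ≤ 2 * i + 1 ∧ 2 * i + 1 ≤ n ∧ p = yv n (2 * i + 1)}
          ∪ {p | ∃ i : ℕ, 2 ≤ 2 * i ∧ 2 * i ≤ n ∧ p = yv n (2 * i) ^ 2}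
          ∪ {yv n n}
          ∪ {p | ∃ J : Finset ℕ, J.Nonempty ∧ J ⊆ Finset.Icc 1 ((n - 1) / 2) ∧
              p = d (∏ j ∈ J, yv n (2 * j))})
  have hker : ∀ p ∈ Subring.closure G, d p = 0 := by
    intro p hp
    induction hp using Subring.closure_induction with
    | mem x hx =>
      rcases hx with ((⟨i, -, -, rfl⟩ | ⟨i, -, -, rfl⟩) | rfl) | ⟨J, -, -, rfl⟩
      · exact hodd _ ⟨i, rfl⟩
      · rw [Derivation.leibniz_pow, two_nsmul, CharTwo.add_self_eq_zero]
      · exact hdn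
      · exact hdd _
    | zero => simp
    | one => simp
    | add x y _ _ hx hy => simp [hx, hy]
    | neg x _ hx => simp [hx]
    | mul x y _ _ hx hy => simp [hx, hy]
  have modd : ∀ i, 3 ≤ 2 * i + 1 → 2 * i + 1 ≤ n → yv n (2 * i + 1) ∈ Subring.closure G :=
    fun i h h' => Subring.subset_closure (Or.inl (Or.inl (Or.inl ⟨i, h, h', rfl⟩)))
  have msq : ∀ i, 1 ≤ i → 2 * i + 1 ≤ n → yv n (2 * i) ^ 2 ∈ Subring.closure G :=
    fun i h h' => Subring.subset_closure
      (Or.inl (Or.inl (Or.inr ⟨i, by omega, by omega, rfl⟩)))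
  have mtop : yv n n ∈ Subring.closure G := Subring.subset_closure (Or.inl (Or.inr rfl))
  have mC : ∀ r : ZMod 2, C r ∈ Subring.closure G := fun r => by
    rw [← ZMod.natCast_zmod_val r, map_natCast]
    exact natCast_mem _ _
  have hspan : ∀ p, p ∈ Submodule.span (Subring.closure G)
      {q | ∃ J ⊆ Finset.Icc 1 ((n - 1) / 2), q = ∏ j ∈ J, yv n (2 * j)} := by
    intro p
    have hsmul : ∀ u ∈ Subring.closure G, ∀ q ∈ Submodule.span (Subring.closure G)
        {q | ∃ J ⊆ Finset.Icc 1 ((n - 1) / 2), q = ∏ j ∈ J, yv n (2 * j)},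
        u * q ∈ Submodule.span (Subring.closure G)
          {q | ∃ J ⊆ Finset.Icc 1 ((n - 1) / 2), q = ∏ j ∈ J, yv n (2 * j)} :=
      fun u hu q hq => Submodule.smul_mem _ (⟨u, hu⟩ : Subring.closure G) hq
    induction p using MvPolynomial.induction_on with
    | C r =>
      rw [← mul_one (C r)]
      exact hsmul _ (mC r) _ (Submodule.subset_span ⟨∅, by simp, by simp⟩)
    | add p q hp hq => exact add_mem hp hq
    | mul_X p c hp =>
      rw [mul_comm]
      rcases hcases c with ⟨i, h1, h2, h⟩ | h | ⟨i, h1, h2, -, h⟩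
      · rw [h]; exact hsmul _ (modd i h1 h2) _ hp
      · rw [h]; exact hsmul _ mtop _ hp
      · rw [h]
        induction hp using Submodule.span_induction with
        | mem q hq =>
          obtain ⟨J, hJ, rfl⟩ := hq
          by_cases hi : i ∈ J
          · rw [← Finset.mul_prod_erase _ _ hi, ← mul_assoc, ← pow_two]
            exact hsmul _ (msq i h1 h2) _
              (Submodule.subset_span ⟨_, (Finset.erase_subset _ _).trans hJ, rfl⟩)
          · rw [← Finset.prod_insert (f := fun j => yv n (2 * j)) hi]
            exact Submodule.subset_span ⟨_, Finset.insert_subset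
              (Finset.mem_Icc.2 (by omega)) hJ, rfl⟩
        | zero => simp
        | add x y _ _ hx hy => rw [mul_add]; exact add_mem hx hy
        | smul u x _ hx => rw [mul_smul_comm]; exact Submodule.smul_mem _ _ hx
  have him : ∀ p, d p ∈ Subring.closure G := by
    intro p
    induction hspan p using Submodule.span_induction with
    | mem q hq =>
      obtain ⟨J, hJ, rfl⟩ := hq
      rcases J.eq_empty_or_nonempty with rfl | hne
      · simp
      · exact Subring.subset_closure (Or.inr ⟨J, hne, hJ, rfl⟩)
    | zero => simp
    | add x y _ _ hx hy => rw [map_add]; exact add_mem hx hy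
    | smul u x _ hx =>
      rw [Subring.smul_def, smul_eq_mul, Derivation.leibniz, hker u u.2, smul_zero, add_zero]
      exact mul_mem u.2 hx
  have hred : ∀ k, 2 * k + 1 ≤ n → ∀ p, d p = 0 → ∃ q r, p = d q + r ∧
      ∀ s ∈ r.support, ∀ c : Fin (n - 1), ∀ i, 1 ≤ i → i ≤ k → (c : ℕ) + 2 = 2 * i →
        Even (s c) := by
    intro k
    induction k with
    | zero => intro _ p _; exact ⟨0, p, by simp, fun _ _ _ i h h' => by omega⟩
    | succ k ih =>
      intro hk p hp
      obtain ⟨q, r, hpq, hr⟩ := ih (by omega) p hp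
      have hdr : d r = 0 := by rw [hpq, map_add, hdd, zero_add] at hp; exact hp
      have h1 := heven (k + 1) (by omega) hk
      have h2 := hodd (2 * (k + 1) + 1) ⟨k + 1, rfl⟩
      rw [yv_eq_X (by omega) (by omega)] at h1 h2
      rw [yv_eq_X (by omega) (by omega)] at h1
      obtain ⟨q', r', hr', hsub, hev⟩ := exists_eq_derivation_add_even
        (by simp only [ne_eq, Fin.mk.injEq]; omega) h1 h2 (by
          intro c hc
          rcases hcases c with ⟨i, -, -, h⟩ | h | ⟨i, h1, h2, h3, h⟩
          · rw [h, hodd _ ⟨i, rfl⟩]; exact zero_mem _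
          · rw [h, hdn]; exact zero_mem _
          · rw [h, heven i h1 h2, yv_eq_X (by omega) h2, X_mem_supported]
            simp only [Set.mem_compl_iff, Set.mem_insert_iff, Set.mem_singleton_iff, Fin.ext_iff,
              not_or] at hc ⊢
            omega) hdr
      refine ⟨q + q', r', by rw [map_add, hpq, hr', add_assoc], fun s hs c i hi hik hci => ?_⟩
      rcases Nat.lt_or_ge k i with h | h
      · have : c = ⟨2 * (k + 1) - 2, by omega⟩ := Fin.ext (by simp only; omega)
        rw [this]
        exact hev s hs
      · exact hr s (hsub hs) c i hi h hci
  ext p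
  refine ⟨fun hp => ?_, hker p⟩
  obtain ⟨q, r, rfl, hr⟩ := hred ((n - 1) / 2) (by omega) p hp
  refine add_mem (him q) ?_
  rw [r.as_sum]
  refine sum_mem fun s hs => ?_
  rw [monomial_eq]
  refine mul_mem (mC _) (prod_mem fun c _ => ?_)
  beta_reduce
  rcases hcases c with ⟨i, h1, h2, h⟩ | h | ⟨i, h1, h2, h3, h⟩
  · rw [h]; exact pow_mem (modd i h1 h2) _
  · rw [h]; exact pow_mem mtop _
  · obtain ⟨m, hm⟩ := (hr s hs c i h1 (by omega) h3).two_dvd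
    rw [h, hm, pow_mul]
    exact pow_mem (msq i h1 h2) _
end
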